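/- arXiv:2404.10546 — 3 statements merged into one kernel-verified Lean document; each statement's English description precedes it below -/
import Mathlib

section
/- Let N ≥ 2, let 0 ≤ γ < 1, let P : Matrix (Fin N) (Fin N) ℝ be row-stochastic, and suppose P satisfies the local-dynamics sparsity condition. Set A := 1 − γ • P (with 1 the identity matrix). Then A is invertible, σ_min(A) > 0, and the condition number satisfies κ(A) ≤ √(N + γ·N·log₂ N) · √(1+γ)/(1−γ). -/
/-- Euclidean norm of a vector in ℝ^N. -/
noncomputable def euclNorm {N : ℕ} (x : Fin N → ℝ) : ℝ :=
  ‖(WithLp.equiv 2 (Fin N → ℝ)).symm x‖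

/-- Largest singular value: supremum of ‖A x‖ over unit vectors x (Euclidean norm). -/
noncomputable def sigmaMax {N : ℕ} (A : Matrix (Fin N) (Fin N) ℝ) : ℝ :=
  sSup {r : ℝ | ∃ x : Fin N → ℝ, euclNorm x = 1 ∧ r = euclNorm (A.mulVec x)}

/-- Smallest singular value: infimum of ‖A x‖ over unit vectors x (Euclidean norm). -/
noncomputable def sigmaMin {N : ℕ} (A : Matrix (Fin N) (Fin N) ℝ) : ℝ :=
  sInf {r : ℝ | ∃ x : Fin N → ℝ, euclNorm x = 1 ∧ r = euclNorm (A.mulVec x)}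

theorem euclNorm_sq_aux {N : ℕ} (x : Fin N → ℝ) : euclNorm x ^ 2 = ∑ i, x i ^ 2 := by
  unfold euclNorm
  rw [EuclideanSpace.norm_sq_eq]
  simp

theorem euclNorm_nonneg_aux {N : ℕ} (x : Fin N → ℝ) : 0 ≤ euclNorm x := norm_nonneg _

theorem upper_aux {N : ℕ} (A B : Matrix (Fin N) (Fin N) ℝ) (r c : ℝ) (hc : 0 ≤ r)
    (hAB : ∀ i j, |A i j| ≤ B i j) (hr : ∀ i, ∑ j, B i j ≤ r) (hcol : ∀ j, ∑ i, B i j ≤ c)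
    (x : Fin N → ℝ) : ∑ i, (A.mulVec x) i ^ 2 ≤ r * c * ∑ i, x i ^ 2 := by
  have hB : ∀ i j, 0 ≤ B i j := fun i j => (abs_nonneg _).trans (hAB i j)
  have h1 : ∀ i, (A.mulVec x) i ^ 2 ≤ r * ∑ j, B i j * x j ^ 2 := by
    intro i
    have h2 : (A.mulVec x) i ^ 2 ≤ (∑ j, |A i j|) * ∑ j, |A i j| * x j ^ 2 := by
      simp only [Matrix.mulVec, dotProduct]
      apply Finset.sum_sq_le_sum_mul_sum_of_sq_eq_mul
      · intro j _; positivity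
      · intro j _; positivity
      · intro j _
        rw [mul_pow, ← sq_abs (A i j)]; ring
    refine h2.trans ?_
    apply mul_le_mul
    · exact (Finset.sum_le_sum fun j _ => hAB i j).trans (hr i)
    · exact Finset.sum_le_sum fun j _ => mul_le_mul_of_nonneg_right (hAB i j) (sq_nonneg _)
    · positivity
    · exact hc
  calc ∑ i, (A.mulVec x) i ^ 2 ≤ ∑ i, r * ∑ j, B i j * x j ^ 2 :=
        Finset.sum_le_sum fun i _ => h1 i
    _ = r * ∑ j, (∑ i, B i j) * x j ^ 2 := by
        rw [← Finset.mul_sum, Finset.sum_comm]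
        simp only [Finset.sum_mul]
    _ ≤ r * ∑ j, c * x j ^ 2 := by
        apply mul_le_mul_of_nonneg_left _ hc
        exact Finset.sum_le_sum fun j _ => mul_le_mul_of_nonneg_right (hcol j) (sq_nonneg _)
    _ = _ := by rw [← Finset.mul_sum]; ring

theorem lower_aux {N : ℕ} (hN : 2 ≤ N) (γ : ℝ) (hγ0 : 0 ≤ γ) (hγ1 : γ < 1)
    (P : Matrix (Fin N) (Fin N) ℝ) (hP : ∀ i j, 0 ≤ P i j) (hr : ∀ i, ∑ j, P i j = 1)
    (x : Fin N → ℝ) :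
    (1 - γ) ^ 2 * ∑ i, x i ^ 2 ≤ N * ∑ i, ((1 - γ • P).mulVec x) i ^ 2 := by
  haveI : Nonempty (Fin N) := ⟨⟨0, by omega⟩⟩
  obtain ⟨k, hk⟩ := Finite.exists_max (fun i => |x i|)
  have h1 : ∑ i, x i ^ 2 ≤ N * x k ^ 2 := by
    calc ∑ i, x i ^ 2 ≤ ∑ i : Fin N, x k ^ 2 :=
          Finset.sum_le_sum fun i _ => sq_le_sq.mpr (hk i)
      _ = _ := by simp
  have h2 : |∑ j, P k j * x j| ≤ |x k| := by
    calc |∑ j, P k j * x j| ≤ ∑ j, |P k j * x j| := Finset.abs_sum_le_sum_abs _ _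
      _ ≤ ∑ j, P k j * |x k| := Finset.sum_le_sum fun j _ => by
          rw [abs_mul, abs_of_nonneg (hP k j)]
          exact mul_le_mul_of_nonneg_left (hk j) (hP k j)
      _ = |x k| := by rw [← Finset.sum_mul, hr, one_mul]
  have h3 : ((1 - γ • P).mulVec x) k = x k - γ * ∑ j, P k j * x j := by
    rw [Matrix.sub_mulVec, Matrix.one_mulVec, Matrix.smul_mulVec]
    simp [Matrix.mulVec, dotProduct]
  have h4 : (1 - γ) * |x k| ≤ |((1 - γ • P).mulVec x) k| := by
    rw [h3]
    have := abs_sub_abs_le_abs_sub (x k) (γ * ∑ j, P k j * x j)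
    rw [abs_mul γ, abs_of_nonneg hγ0] at this
    nlinarith [mul_le_mul_of_nonneg_left h2 hγ0]
  have h5 : (1 - γ) ^ 2 * x k ^ 2 ≤ ((1 - γ • P).mulVec x) k ^ 2 := by
    have := pow_le_pow_left₀ (mul_nonneg (by linarith) (abs_nonneg _)) h4 2
    rwa [mul_pow, sq_abs, sq_abs] at this
  have h6 : ((1 - γ • P).mulVec x) k ^ 2 ≤ ∑ i, ((1 - γ • P).mulVec x) i ^ 2 :=
    Finset.single_le_sum (f := fun i => ((1 - γ • P).mulVec x) i ^ 2)
      (fun i _ => sq_nonneg _) (Finset.mem_univ k)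
  calc (1 - γ) ^ 2 * ∑ i, x i ^ 2 ≤ (1 - γ) ^ 2 * (N * x k ^ 2) :=
        mul_le_mul_of_nonneg_left h1 (sq_nonneg _)
    _ = N * ((1 - γ) ^ 2 * x k ^ 2) := by ring
    _ ≤ _ := mul_le_mul_of_nonneg_left (h5.trans h6) (Nat.cast_nonneg _)

theorem conditionNumber_bound_local_dynamics
    (N : ℕ) (hN : 2 ≤ N) (γ : ℝ) (hγ0 : 0 ≤ γ) (hγ1 : γ < 1)
    (P : Matrix (Fin N) (Fin N) ℝ)
    (hPnonneg : ∀ i j, 0 ≤ P i j)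
    (hProw : ∀ i, ∑ j, P i j = 1)
    (hrow_sparse : ∀ i, ((Finset.univ.filter fun j => P i j ≠ 0).card : ℝ) ≤ Real.logb 2 N)
    (hcol_sparse : ∀ j, ((Finset.univ.filter fun i => P i j ≠ 0).card : ℝ) ≤ Real.logb 2 N)
    (A : Matrix (Fin N) (Fin N) ℝ) (hA : A = 1 - γ • P) :
    IsUnit A.det ∧ 0 < sigmaMin A ∧
      sigmaMax A / sigmaMin A ≤
        Real.sqrt (N + γ * N * Real.logb 2 N) * (Real.sqrt (1 + γ) / (1 - γ)) := by
  have hL := lower_aux hN γ hγ0 hγ1 P hPnonneg hProw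
  rw [← hA] at hL
  have hNpos : (0 : ℝ) < N := by exact_mod_cast (by omega : 0 < N)
  have hg : 0 < 1 - γ := by linarith
  set L := Real.logb 2 N with hLdef
  have hL0 : 0 ≤ L := (Nat.cast_nonneg _).trans (hrow_sparse ⟨0, by omega⟩)
  have hP1 : ∀ i j, P i j ≤ 1 := fun i j => by
    rw [← hProw i]
    exact Finset.single_le_sum (f := fun j => P i j)
      (fun j _ => hPnonneg i j) (Finset.mem_univ j)
  have hcolsum : ∀ j, ∑ i, P i j ≤ L := fun j => by
    refine le_trans ?_ (hcol_sparse j)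
    rw [← Finset.sum_filter_ne_zero]
    refine (Finset.sum_le_sum fun i _ => hP1 i j).trans ?_
    simp
  have hU : ∀ x : Fin N → ℝ,
      ∑ i, (A.mulVec x) i ^ 2 ≤ (1 + γ) * (1 + γ * L) * ∑ i, x i ^ 2 := by
    apply upper_aux A (1 + γ • P) (1 + γ) (1 + γ * L) (by linarith)
    · intro i j
      rw [hA]
      simp only [Matrix.sub_apply, Matrix.add_apply, Matrix.smul_apply, smul_eq_mul]
      have h1 := mul_nonneg hγ0 (hPnonneg i j)
      have h2 : (0 : ℝ) ≤ (1 : Matrix (Fin N) (Fin N) ℝ) i j := by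
        rw [Matrix.one_apply]; split_ifs <;> norm_num
      rw [abs_le]; constructor <;> linarith
    · intro i
      simp only [Matrix.add_apply, Matrix.smul_apply, smul_eq_mul, Finset.sum_add_distrib,
        ← Finset.mul_sum, hProw, Matrix.one_apply]
      simp
    · intro j
      simp only [Matrix.add_apply, Matrix.smul_apply, smul_eq_mul, Finset.sum_add_distrib,
        ← Finset.mul_sum, Matrix.one_apply]
      simpa using mul_le_mul_of_nonneg_left (hcolsum j) hγ0
  have hne : {r : ℝ | ∃ x : Fin N → ℝ,
      euclNorm x = 1 ∧ r = euclNorm (A.mulVec x)}.Nonempty := by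
    refine ⟨_, Pi.single ⟨0, by omega⟩ 1, ?_, rfl⟩
    have := euclNorm_sq_aux (N := N) (Pi.single ⟨0, by omega⟩ 1)
    have h1 : ∑ i, (Pi.single (⟨0, by omega⟩ : Fin N) (1 : ℝ) : Fin N → ℝ) i ^ 2 = 1 := by
      simp [Pi.single_apply]
    rw [h1] at this
    exact (pow_eq_one_iff_of_nonneg (euclNorm_nonneg_aux _) two_ne_zero).mp this
  have hmin : (1 - γ) / Real.sqrt N ≤ sigmaMin A := by
    apply le_csInf hne
    rintro r ⟨x, hx, rfl⟩
    have h := hL x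
    rw [← euclNorm_sq_aux, ← euclNorm_sq_aux, hx] at h
    refine abs_le_of_sq_le_sq' ?_ (euclNorm_nonneg_aux _) |>.2
    rw [div_pow, Real.sq_sqrt hNpos.le, div_le_iff₀ hNpos]
    linarith
  have hmax : sigmaMax A ≤ Real.sqrt ((1 + γ) * (1 + γ * L)) := by
    apply csSup_le hne
    rintro r ⟨x, hx, rfl⟩
    have h := hU x
    rw [← euclNorm_sq_aux, ← euclNorm_sq_aux, hx] at h
    apply Real.le_sqrt_of_sq_le
    linarith
  have hpos : 0 < (1 - γ) / Real.sqrt N := div_pos hg (Real.sqrt_pos.mpr hNpos)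
  refine ⟨?_, hpos.trans_le hmin, ?_⟩
  · rw [isUnit_iff_ne_zero]
    intro hdet
    obtain ⟨v, hv, hv0⟩ := Matrix.exists_mulVec_eq_zero_iff.mpr hdet
    have h := hL v
    rw [hv0] at h
    simp only [Pi.zero_apply, ne_eq, OfNat.ofNat_ne_zero, not_false_eq_true, zero_pow,
      Finset.sum_const_zero, mul_zero] at h
    have h2 : ∑ i, v i ^ 2 ≤ 0 := by
      by_contra hc
      push Not at hc
      have := mul_pos (pow_pos hg 2) hc
      linarith
    apply hv
    funext i
    have h3 := Finset.single_le_sum (f := fun i => v i ^ 2)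
      (fun i _ => sq_nonneg _) (Finset.mem_univ i)
    have h4 : v i ^ 2 = 0 := le_antisymm (h3.trans h2) (sq_nonneg _)
    simpa using h4
  · calc sigmaMax A / sigmaMin A
        ≤ Real.sqrt ((1 + γ) * (1 + γ * L)) / ((1 - γ) / Real.sqrt N) :=
          div_le_div₀ (Real.sqrt_nonneg _) hmax hpos hmin
      _ = Real.sqrt (N + γ * N * L) * (Real.sqrt (1 + γ) / (1 - γ)) := by
          rw [show (N : ℝ) + γ * N * L = N * (1 + γ * L) by ring,
            Real.sqrt_mul (by linarith), Real.sqrt_mul hNpos.le, div_div_eq_mul_div]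
          ring
end

section
/- Let N ≥ 1, let 0 ≤ γ < 1, and let P : Matrix (Fin N) (Fin N) ℝ be row-stochastic. Then A := 1 − γ • P (with 1 the identity matrix) is invertible and its smallest singular value satisfies σ_min(A) ≥ (1−γ)/√N; that is, for every x ∈ ℝ^N with Euclidean norm ‖x‖ = 1, one has ‖A.mulVec x‖ ≥ (1−γ)/√N. -/
theorem stoch_key
    (N : ℕ) (hN : 1 ≤ N) (γ : ℝ) (hγ0 : 0 ≤ γ)
    (P : Matrix (Fin N) (Fin N) ℝ)
    (hPnonneg : ∀ i j, 0 ≤ P i j)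
    (hProw : ∀ i, ∑ j, P i j = 1) (x : Fin N → ℝ) :
    ∃ i, (∀ j, |x j| ≤ |x i|) ∧ (1 - γ) * |x i| ≤ |((1 - γ • P).mulVec x) i| := by
  haveI : Nonempty (Fin N) := ⟨⟨0, hN⟩⟩
  obtain ⟨i, hi⟩ := Finite.exists_max (fun j => |x j|)
  refine ⟨i, hi, ?_⟩
  have h1 : ((1 - γ • P).mulVec x) i = x i - γ * ∑ j, P i j * x j := by
    rw [Matrix.sub_mulVec, Matrix.one_mulVec, Matrix.smul_mulVec]
    simp [Matrix.mulVec, dotProduct]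
  have h2 : |∑ j, P i j * x j| ≤ |x i| := by
    calc |∑ j, P i j * x j| ≤ ∑ j, |P i j * x j| := Finset.abs_sum_le_sum_abs _ _
      _ ≤ ∑ j, P i j * |x i| := by
          apply Finset.sum_le_sum
          intro j _
          rw [abs_mul, abs_of_nonneg (hPnonneg i j)]
          exact mul_le_mul_of_nonneg_left (hi j) (hPnonneg i j)
      _ = |x i| := by rw [← Finset.sum_mul, hProw, one_mul]
  have h3 := abs_sub_abs_le_abs_sub (x i) (γ * ∑ j, P i j * x j)
  rw [abs_mul, abs_of_nonneg hγ0] at h3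
  have h4 := mul_le_mul_of_nonneg_left h2 hγ0
  rw [h1]
  linarith

theorem abs_le_euclNorm {N : ℕ} (x : Fin N → ℝ) (i : Fin N) : |x i| ≤ euclNorm x := by
  have := PiLp.norm_apply_le ((WithLp.equiv 2 (Fin N → ℝ)).symm x) i
  simpa [euclNorm] using this

theorem sigmaMin_one_sub_smul_stochastic_ge
    (N : ℕ) (hN : 1 ≤ N) (γ : ℝ) (hγ0 : 0 ≤ γ) (hγ1 : γ < 1)
    (P : Matrix (Fin N) (Fin N) ℝ)
    (hPnonneg : ∀ i j, 0 ≤ P i j)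
    (hProw : ∀ i, ∑ j, P i j = 1)
    (A : Matrix (Fin N) (Fin N) ℝ) (hA : A = 1 - γ • P) :
    IsUnit A.det ∧ sigmaMin A ≥ (1 - γ) / Real.sqrt N ∧
      ∀ x : Fin N → ℝ, euclNorm x = 1 →
        euclNorm (A.mulVec x) ≥ (1 - γ) / Real.sqrt N := by
  have key := stoch_key N hN γ hγ0 P hPnonneg hProw
  rw [← hA] at key
  have hg : 0 < 1 - γ := by linarith
  have hNpos : (0 : ℝ) < N := by exact_mod_cast hN
  have hs : 0 < Real.sqrt N := Real.sqrt_pos.mpr hNpos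
  have main : ∀ x : Fin N → ℝ, euclNorm x = 1 →
        euclNorm (A.mulVec x) ≥ (1 - γ) / Real.sqrt N := by
    intro x hx
    obtain ⟨i, hi, hk⟩ := key x
    have h1 : (1 : ℝ) ≤ Real.sqrt N * |x i| := by
      have h2 : euclNorm x ≤ Real.sqrt (N * |x i| ^ 2) := by
        unfold euclNorm
        rw [EuclideanSpace.norm_eq]
        apply Real.sqrt_le_sqrt
        calc _ ≤ ∑ _j : Fin N, |x i| ^ 2 := by
              apply Finset.sum_le_sum
              intro j _
              exact pow_le_pow_left₀ (abs_nonneg _) (hi j) 2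
          _ = _ := by simp
      rwa [hx, Real.sqrt_mul hNpos.le, Real.sqrt_sq (abs_nonneg _)] at h2
    have h3 := abs_le_euclNorm (A.mulVec x) i
    have h4 : (1 - γ) / Real.sqrt N ≤ (1 - γ) * |x i| := by
      rw [div_le_iff₀ hs]
      nlinarith
    linarith
  refine ⟨?_, ?_, main⟩
  · rw [isUnit_iff_ne_zero]
    intro hdet
    obtain ⟨v, hv, hv0⟩ := Matrix.exists_mulVec_eq_zero_iff.mpr hdet
    obtain ⟨i, hi, hk⟩ := key v
    rw [hv0, Pi.zero_apply, abs_zero] at hk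
    have h0 : |v i| ≤ 0 := by
      by_contra! h
      have := mul_pos hg h
      linarith
    apply hv
    funext j
    exact abs_nonpos_iff.mp ((hi j).trans h0)
  · apply le_csInf
    · refine ⟨_, Pi.single ⟨0, hN⟩ 1, ?_, rfl⟩
      unfold euclNorm
      rw [EuclideanSpace.norm_eq]
      simp [Pi.single_apply]
    · rintro r ⟨x, hx, rfl⟩
      exact main x hx
end

section
/- Let N ≥ 2, let 0 ≤ γ ≤ 1, let P : Matrix (Fin N) (Fin N) ℝ be row-stochastic, and suppose P satisfies the local-dynamics sparsity condition. Then the largest singular value of A := 1 − γ • P (with 1 the identity matrix) satisfies σ_max(A) ≤ √(1+γ) · √(1 + γ·log₂ N). -/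
theorem sigmaMax_bound_local_dynamics
    (N : ℕ) (hN : 2 ≤ N) (γ : ℝ) (hγ0 : 0 ≤ γ) (hγ1 : γ ≤ 1)
    (P : Matrix (Fin N) (Fin N) ℝ)
    (hPnonneg : ∀ i j, 0 ≤ P i j)
    (hProw : ∀ i, ∑ j, P i j = 1)
    (hrow_sparse : ∀ i, ((Finset.univ.filter fun j => P i j ≠ 0).card : ℝ) ≤ Real.logb 2 N)
    (hcol_sparse : ∀ j, ((Finset.univ.filter fun i => P i j ≠ 0).card : ℝ) ≤ Real.logb 2 N)
    (A : Matrix (Fin N) (Fin N) ℝ) (hA : A = 1 - γ • P) :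
    sigmaMax A ≤ Real.sqrt (1 + γ) * Real.sqrt (1 + γ * Real.logb 2 N) := by
  have hcol : ∀ j, ∑ i, P i j ≤ Real.logb 2 N := by
    intro j
    refine le_trans ?_ (hcol_sparse j)
    rw [Finset.card_filter]
    push_cast
    refine Finset.sum_le_sum fun i _ => ?_
    by_cases h : P i j = 0
    · simp [h]
    · simp only [ne_eq, h, not_false_eq_true, if_true]
      rw [← hProw i]
      exact Finset.single_le_sum (f := fun j => P i j) (fun k _ => hPnonneg i k) (Finset.mem_univ j)
  have hsq : ∀ x : Fin N → ℝ, euclNorm x = Real.sqrt (∑ i, x i ^ 2) := by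
    intro x
    simp [euclNorm, EuclideanSpace.norm_eq]
  unfold sigmaMax
  refine Real.sSup_le ?_ (by positivity)
  rintro r ⟨x, hx, rfl⟩
  rw [hsq] at hx ⊢
  rw [Real.sqrt_eq_one] at hx
  rw [← Real.sqrt_mul (by linarith)]
  apply Real.sqrt_le_sqrt
  have hrow : ∀ i, (A.mulVec x i) ^ 2 ≤ (1 + γ) * (x i ^ 2 + γ * ∑ j, P i j * x j ^ 2) := by
    intro i
    have e : A.mulVec x i = x i - γ * ∑ j, P i j * x j := by
      rw [hA, Matrix.sub_mulVec, Matrix.one_mulVec, Matrix.smul_mulVec]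
      simp [Matrix.mulVec, dotProduct]
    have jen : (∑ j, P i j * x j) ^ 2 ≤ ∑ j, P i j * x j ^ 2 := by
      have h := Finset.sum_nonneg (s := Finset.univ) (f := fun j => P i j * (x j - ∑ k, P i k * x k) ^ 2)
        (fun j _ => mul_nonneg (hPnonneg i j) (sq_nonneg _))
      generalize hy : ∑ k, P i k * x k = y at *
      have e2 : ∑ j, P i j * (x j - y) ^ 2
          = ∑ j, P i j * x j ^ 2 - 2 * y * ∑ j, P i j * x j + y ^ 2 * ∑ j, P i j := by
        rw [Finset.mul_sum, Finset.mul_sum, ← Finset.sum_sub_distrib, ← Finset.sum_add_distrib]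
        exact Finset.sum_congr rfl fun j _ => by ring
      rw [e2, hProw, hy] at h
      nlinarith
    rw [e]
    generalize ∑ k, P i k * x k = y at *
    have h1 : 0 ≤ γ * (x i + y) ^ 2 := by positivity
    have h2 := mul_le_mul_of_nonneg_left jen (show 0 ≤ (1 + γ) * γ by positivity)
    nlinarith
  refine (Finset.sum_le_sum fun i _ => hrow i).trans ?_
  rw [← Finset.mul_sum, Finset.sum_add_distrib, hx, ← Finset.mul_sum, Finset.sum_comm]
  have key : ∑ j, ∑ i, P i j * x j ^ 2 ≤ Real.logb 2 N := by
    calc ∑ j, ∑ i, P i j * x j ^ 2 ≤ ∑ j, Real.logb 2 N * x j ^ 2 := by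
          refine Finset.sum_le_sum fun j _ => ?_
          rw [← Finset.sum_mul]
          exact mul_le_mul_of_nonneg_right (hcol j) (sq_nonneg _)
      _ = Real.logb 2 N := by rw [← Finset.mul_sum, hx, mul_one]
  gcongr
end
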